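/- arXiv:1108.5475 — 5 statements merged into one kernel-verified Lean document; each statement's English description precedes it below -/
import Mathlib

section
/- Let C ⊆ F_{q^m}^n be an F_{q^m}-linear code of dimension k, let C ∩ F_q^n denote its subfield-subcode, and let tr|_{C^⊥} denote the restriction to the dual code C^⊥ of the componentwise trace map from F_{q^m}^n to F_q^n. Then dim_{F_q}(C ∩ F_q^n) = n − m(n − k) + dim_{F_q}(ker tr|_{C^⊥}). -/
open Finset

section DotForm

variable (F ι : Type*) [Field F] [Fintype ι]

/-- The standard bilinear form on `ι → F`. -/
abbrev dotForm : LinearMap.BilinForm F (ι → F) := dotProductBilin F F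

theorem dotForm_isRefl : (dotForm F ι).IsRefl := fun x y h => by
  simpa [dotProduct_comm y x] using h

theorem dotForm_nondegenerate : (dotForm F ι).Nondegenerate := by
  refine (dotForm_isRefl F ι).nondegenerate_iff_separatingLeft.2 fun x hx => ?_
  exact dotProduct_eq_zero x fun y => by simpa using hx y

variable {F ι}

theorem finrank_orthogonal_dotForm (W : Submodule F (ι → F)) :
    Module.finrank F ((dotForm F ι).orthogonal W) = Fintype.card ι - Module.finrank F W := by
  rw [LinearMap.BilinForm.finrank_orthogonal (dotForm_nondegenerate F ι),
    Module.finrank_fintype_fun_eq_card]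

end DotForm

section Delsarte

variable {K F ι : Type*} [Field K] [Field F] [Algebra K F] [Fintype ι]

theorem trace_dotProduct_algebraMap (x : ι → F) (v : ι → K) :
    Algebra.trace K F (x ⬝ᵥ fun i => algebraMap K F (v i)) =
      (fun i => Algebra.trace K F (x i)) ⬝ᵥ v := by
  simp only [dotProduct, map_sum]
  refine Finset.sum_congr rfl fun i _ => ?_
  rw [mul_comm, ← Algebra.smul_def, map_smul, smul_eq_mul, mul_comm]

variable [FiniteDimensional K F] [Algebra.IsSeparable K F]

/-- **Delsarte's theorem**: the dual of the trace code of `Cᗮ` is the subfield subcode of `C`. -/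
theorem orthogonal_map_trace_orthogonal (C : Submodule F (ι → F)) :
    (dotForm K ι).orthogonal
        ((((dotForm F ι).orthogonal C).restrictScalars K).map
          ((Algebra.trace K F).compLeft ι)) =
      (C.restrictScalars K).comap ((Algebra.linearMap K F).compLeft ι) := by
  ext v
  have hC := LinearMap.BilinForm.orthogonal_orthogonal (dotForm_nondegenerate F ι)
    (dotForm_isRefl F ι) C
  rw [Submodule.mem_comap, Submodule.restrictScalars_mem]
  conv_rhs => rw [← hC]
  rw [LinearMap.BilinForm.mem_orthogonal_iff, LinearMap.BilinForm.mem_orthogonal_iff]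
  constructor
  · intro h x hx
    by_contra hne
    obtain ⟨a, ha⟩ := Algebra.trace_surjective K F 1
    set s : F := x ⬝ᵥ fun i => algebraMap K F (v i) with hs
    have hs0 : s ≠ 0 := hne
    have key := h _ (Submodule.mem_map_of_mem
      (show (a / s) • x ∈ ((dotForm F ι).orthogonal C).restrictScalars K from
        Submodule.smul_mem _ _ hx))
    have h' := trace_dotProduct_algebraMap ((a / s) • x) v
    rw [smul_dotProduct, ← hs, smul_eq_mul, div_mul_cancel₀ _ hs0, ha] at h'
    exact one_ne_zero (h'.trans key)
  · rintro h _ ⟨x, hx, rfl⟩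
    have hx0 : x ⬝ᵥ (fun i => algebraMap K F (v i)) = 0 := h x hx
    have h' := trace_dotProduct_algebraMap x v
    rw [hx0, map_zero] at h'
    exact h'.symm

/-- Dimension formula for subfield subcodes over a finite separable extension. -/
theorem finrank_subfieldSubcode_add (C : Submodule F (ι → F)) :
    Module.finrank K ((C.restrictScalars K).comap ((Algebra.linearMap K F).compLeft ι)) +
        Module.finrank K F * (Fintype.card ι - Module.finrank F C) =
      Fintype.card ι + Module.finrank K
        (((dotForm F ι).orthogonal C).restrictScalars K ⊓
          LinearMap.ker ((Algebra.trace K F).compLeft ι) : Submodule K (ι → F)) := by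
  set D := (dotForm F ι).orthogonal C with hD
  set T := (Algebra.trace K F).compLeft ι
  have hrank := (T.domRestrict (D.restrictScalars K)).finrank_range_add_finrank_ker
  have hrange : LinearMap.range (T.domRestrict (D.restrictScalars K)) =
      (D.restrictScalars K).map T := by
    rw [LinearMap.range_domRestrict]
  have hker : Module.finrank K (LinearMap.ker (T.domRestrict (D.restrictScalars K))) =
      Module.finrank K (D.restrictScalars K ⊓ LinearMap.ker T : Submodule K (ι → F)) := by
    rw [LinearMap.ker_domRestrict, ← Submodule.map_comap_subtype, Submodule.finrank_map_subtype_eq]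
  have hdim : Module.finrank K (D.restrictScalars K) =
      Module.finrank K F * (Fintype.card ι - Module.finrank F C) := by
    rw [← finrank_orthogonal_dotForm, ← hD]
    exact (Module.finrank_mul_finrank K F D).symm
  have hle : Module.finrank K ((D.restrictScalars K).map T) ≤ Fintype.card ι := by
    simpa using ((D.restrictScalars K).map T).finrank_le
  rw [hrange, hker, hdim] at hrank
  rw [← orthogonal_map_trace_orthogonal, finrank_orthogonal_dotForm, ← hrank, ← add_assoc,
    Nat.sub_add_cancel hle]

end Delsarte

/-- (Dimension formula via Delsarte's theorem.) For an `F_{q^m}`-linear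
code `C ⊆ F_{q^m}^n` of dimension `k`, with dual code `C^⊥` (w.r.t. the standard
bilinear form), subfield-subcode `C ∩ F_q^n`, and `K` the kernel of the componentwise
trace map restricted to `C^⊥`:
`dim_{F_q}(C ∩ F_q^n) = n - m(n - k) + dim_{F_q} K`
(stated additively to avoid truncated subtraction). -/
theorem stmt_2 (q m n : ℕ) (hq : IsPrimePow q) (hm : 1 ≤ m)
    (Fq F : Type) [Field Fq] [Fintype Fq] [Field F] [Fintype F] [Algebra Fq F]
    (hcq : Fintype.card Fq = q) (hcF : Fintype.card F = q ^ m)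
    (C : Submodule F (Fin n → F)) (k : ℕ) (hk : k = Module.finrank F C)
    (Cperp : Submodule F (Fin n → F))
    (hCperp : ∀ x, x ∈ Cperp ↔ ∀ c ∈ C, ∑ i, x i * c i = 0)
    (SS : Submodule Fq (Fin n → F))
    (hSS : ∀ x, x ∈ SS ↔ x ∈ C ∧ ∀ i, x i ∈ Set.range (algebraMap Fq F))
    (K : Submodule Fq (Fin n → F))
    (hK : ∀ x, x ∈ K ↔ x ∈ Cperp ∧ ∀ i, ∑ j ∈ Finset.range m, x i ^ q ^ j = 0) :
    Module.finrank Fq SS + m * (n - k) = n + Module.finrank Fq K := by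
  subst hk
  have hfr : Module.finrank Fq F = m := by
    have h := Module.card_eq_pow_finrank (K := Fq) (V := F)
    rw [hcF, hcq] at h
    exact (Nat.pow_right_injective hq.two_le h).symm
  have hD : (dotForm F (Fin n)).orthogonal C = Cperp := by
    ext x
    rw [hCperp, LinearMap.BilinForm.mem_orthogonal_iff]
    refine forall₂_congr fun c _ => ?_
    simp [dotProduct, mul_comm]
  have hKeq : K = Cperp.restrictScalars Fq ⊓
      LinearMap.ker ((Algebra.trace Fq F).compLeft (Fin n)) := by
    ext x
    rw [hK, Submodule.mem_inf, Submodule.restrictScalars_mem, LinearMap.mem_ker, funext_iff]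
    refine and_congr_right fun _ => forall_congr' fun i => ?_
    have h := FiniteField.algebraMap_trace_eq_sum_pow Fq F (x i)
    rw [hfr, Nat.card_eq_fintype_card, hcq] at h
    rw [← h, FaithfulSMul.algebraMap_eq_zero_iff]
    rfl
  have hinj : Function.Injective ((Algebra.linearMap Fq F).compLeft (Fin n)) :=
    fun v w h => funext fun i => (algebraMap Fq F).injective (congrFun h i)
  have hSSeq : SS = ((C.restrictScalars Fq).comap
      ((Algebra.linearMap Fq F).compLeft (Fin n))).map
        ((Algebra.linearMap Fq F).compLeft (Fin n)) := by
    ext x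
    rw [hSS, Submodule.mem_map]
    constructor
    · rintro ⟨hx, hr⟩
      choose v hv using hr
      obtain rfl : (Algebra.linearMap Fq F).compLeft (Fin n) v = x := funext hv
      exact ⟨v, hx, rfl⟩
    · rintro ⟨v, hv, rfl⟩
      exact ⟨hv, fun i => ⟨v i, rfl⟩⟩
  have main := finrank_subfieldSubcode_add (K := Fq) C
  rw [hD, ← hKeq, hfr, Fintype.card_fin] at main
  rw [hSSeq, (Submodule.equivMapOfInjective _ hinj _).finrank_eq.symm, main]
end

section
/- For g ∈ R the following conditions are equivalent: (1) g = T(h) for some h ∈ R; (2) g^q = g in R; (3) g(α) ∈ F_q for every α ∈ F_{q^m}^*. -/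
open Polynomial

/-- An element of an extension of a finite field `K` lies in `K` iff it is fixed by `x ↦ x ^ #K`. -/
theorem mem_range_algebraMap_iff_pow_card {K L : Type*} [Field K] [Fintype K] [Field L]
    [Algebra K L] (x : L) :
    x ∈ Set.range (algebraMap K L) ↔ x ^ Fintype.card K = x := by
  constructor
  · rintro ⟨y, rfl⟩
    rw [← map_pow, FiniteField.pow_card]
  · intro hx
    have hprod : (X ^ Fintype.card K - X : K[X]) = ∏ a : K, (X - C a) := by
      have hroots := FiniteField.roots_X_pow_card_sub_X K
      have hmonic : (X ^ Fintype.card K - X : K[X]).Monic :=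
        monic_X_pow_sub (by simpa using Fintype.one_lt_card)
      rw [← prod_multiset_X_sub_C_of_monic_of_roots_card_eq hmonic, hroots]
      · rfl
      · rw [hroots, FiniteField.X_pow_card_sub_X_natDegree_eq K Fintype.one_lt_card]
        rfl
    have h := congrArg (aeval x) hprod
    simp only [map_sub, map_pow, aeval_X, hx, sub_self, map_prod, aeval_C] at h
    obtain ⟨a, -, ha⟩ := Finset.prod_eq_zero_iff.mp h.symm
    exact ⟨a, (sub_eq_zero.mp ha).symm⟩

/-- Over a finite field, two polynomials are congruent modulo `X ^ (#F - 1) - 1` iff they agree at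
all units. -/
theorem quotient_mk_eq_iff_eval_units {F : Type*} [Field F] [Fintype F] (f g : F[X]) :
    Ideal.Quotient.mk (Ideal.span {(X : F[X]) ^ (Fintype.card F - 1) - 1}) f =
        Ideal.Quotient.mk (Ideal.span {(X : F[X]) ^ (Fintype.card F - 1) - 1}) g ↔
      ∀ β : Fˣ, f.eval (β : F) = g.eval (β : F) := by
  classical
  rw [Ideal.Quotient.eq, Ideal.mem_span_singleton]
  constructor
  · rintro ⟨r, hr⟩ β
    have h := congrArg (eval (β : F)) hr
    simpa [FiniteField.pow_card_sub_one_eq_one (β : F) β.ne_zero, sub_eq_zero] using h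
  · intro h
    have hnodal := Lagrange.nodal_subgroup_eq_X_pow_card_sub_one (⊤ : Subgroup Fˣ)
    have hcard : Fintype.card (⊤ : Subgroup Fˣ) = Fintype.card F - 1 := by
      rw [← Fintype.card_units, ← Nat.card_eq_fintype_card, ← Nat.card_eq_fintype_card,
        Subgroup.card_top]
    rw [hcard] at hnodal
    rw [← hnodal, Lagrange.nodal]
    refine Finset.prod_dvd_of_coprime (fun a _ b _ hab => ?_) fun a _ => ?_
    · exact isCoprime_X_sub_C_of_isUnit_sub
        (sub_ne_zero.mpr fun hc => hab (Units.ext hc)).isUnit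
    · rw [dvd_iff_isRoot, IsRoot, eval_sub, h a, sub_self]

/-- Every function on the units of a finite field is given by a polynomial. -/
theorem exists_polynomial_eval_units {F : Type*} [Field F] [Fintype F] (v : Fˣ → F) :
    ∃ f : F[X], ∀ β : Fˣ, f.eval (β : F) = v β := by
  classical
  exact ⟨Lagrange.interpolate Finset.univ (fun β : Fˣ => (β : F)) v, fun β =>
    Lagrange.eval_interpolate_at_node v Units.val_injective.injOn (Finset.mem_univ β)⟩



/-- For `g ∈ R = F_{q^m}[x]/⟨x^N - 1⟩` the following are equivalent:
(1) `g = T(h)` for some `h ∈ R`, where `T(h) = h + h^q + ... + h^{q^{m-1}}`;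
(2) `g^q = g` in `R`;
(3) `g(α) ∈ F_q` for every `α ∈ F_{q^m}^*`.
Evaluation on `R` is represented by a function `ev` agreeing with polynomial
evaluation at nonzero points. -/
theorem stmt_5 (q m : ℕ) (hq : IsPrimePow q) (hm : 1 ≤ m)
    (Fq F : Type) [Field Fq] [Fintype Fq] [Field F] [Fintype F] [Algebra Fq F]
    (hcq : Fintype.card Fq = q) (hcF : Fintype.card F = q ^ m)
    (N : ℕ) (hN : N = q ^ m - 1)
    (ev : (Polynomial F ⧸ Ideal.span {(X : Polynomial F) ^ N - 1}) → F → F)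
    (hev : ∀ (f : Polynomial F) (β : Fˣ),
      ev (Ideal.Quotient.mk (Ideal.span {(X : Polynomial F) ^ N - 1}) f) ↑β = f.eval ↑β)
    (T : (Polynomial F ⧸ Ideal.span {(X : Polynomial F) ^ N - 1}) →
         (Polynomial F ⧸ Ideal.span {(X : Polynomial F) ^ N - 1}))
    (hT : ∀ f, T f = ∑ i ∈ Finset.range m, f ^ q ^ i)
    (g : Polynomial F ⧸ Ideal.span {(X : Polynomial F) ^ N - 1}) :
    ((∃ h, g = T h) ↔ g ^ q = g) ∧
    (g ^ q = g ↔ ∀ α : Fˣ, ev g ↑α ∈ Set.range (algebraMap Fq F)) := by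
  have hfin : Module.finrank Fq F = m := by
    have h := Module.card_eq_pow_finrank (K := Fq) (V := F)
    rw [hcF, hcq] at h
    exact (Nat.pow_right_injective hq.two_le h).symm
  have htrace (x : F) : algebraMap Fq F (Algebra.trace Fq F x) =
      ∑ i ∈ Finset.range m, x ^ q ^ i := by
    rw [FiniteField.algebraMap_trace_eq_sum_pow, hfin, Nat.card_eq_fintype_card, hcq]
  have hfix (x : F) : x ∈ Set.range (algebraMap Fq F) ↔ x ^ q = x := by
    rw [← hcq]
    exact mem_range_algebraMap_iff_pow_card x
  rw [← hcF] at hN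
  subst hN
  obtain ⟨p, rfl⟩ := Ideal.Quotient.mk_surjective g
  have hpow : Ideal.Quotient.mk (Ideal.span {(X : F[X]) ^ (Fintype.card F - 1) - 1}) p ^ q =
        Ideal.Quotient.mk _ p ↔
      ∀ α : Fˣ, p.eval (α : F) ∈ Set.range (algebraMap Fq F) := by
    rw [← map_pow, quotient_mk_eq_iff_eval_units]
    simp only [eval_pow, hfix]
  simp only [hev]
  refine ⟨?_, hpow⟩
  rw [hpow]
  constructor
  · rintro ⟨h, hh⟩ α
    obtain ⟨r, rfl⟩ := Ideal.Quotient.mk_surjective h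
    simp only [hT, ← map_pow, ← map_sum] at hh
    rw [quotient_mk_eq_iff_eval_units] at hh
    refine ⟨Algebra.trace Fq F (r.eval (α : F)), ?_⟩
    rw [htrace, hh α, eval_finsetSum]
    simp only [eval_pow]
  · intro hp
    choose c hc using hp
    choose y hy using fun α : Fˣ => Algebra.trace_surjective Fq F (c α)
    obtain ⟨r, hr⟩ := exists_polynomial_eval_units y
    refine ⟨Ideal.Quotient.mk _ r, ?_⟩
    simp only [hT, ← map_pow, ← map_sum]
    rw [quotient_mk_eq_iff_eval_units]
    intro α
    rw [eval_finsetSum, ← hc, ← hy, htrace]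
    simp only [eval_pow, hr]
end

section
/- Let g, f ∈ R with g cyclotomic, let Z_g = {α ∈ F_{q^m}^* : g(α) = 0} and let Z_g^c be its complement in F_{q^m}^*. Then tr((fg)(α)) = 0 for every α ∈ Z_g^c if and only if T(fg) = 0 in R; moreover T(fg) = 0 if and only if g·T(f) = 0 in R. -/
open Polynomial

/-- A polynomial vanishing at every unit of a finite field is divisible by
`X ^ (card F - 1) - 1`. -/
theorem X_pow_card_sub_one_dvd_of_eval_units_eq_zero {F : Type*} [Field F] [Fintype F]
    {p : F[X]} (hp : ∀ α : Fˣ, p.eval (α : F) = 0) :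
    (X : F[X]) ^ (Fintype.card F - 1) - 1 ∣ p := by
  classical
  have hN : Fintype.card F - 1 ≠ 0 := (Nat.sub_pos_of_lt Fintype.one_lt_card).ne'
  have hmonic : ((X : F[X]) ^ (Fintype.card F - 1) - 1).Monic := by
    simpa using monic_X_pow_sub_C (1 : F) hN
  rw [← modByMonic_eq_zero_iff_dvd hmonic]
  refine eq_zero_of_natDegree_lt_card_of_eval_eq_zero _ (f := fun α : Fˣ => (α : F))
    Units.val_injective (fun α => ?_) ?_
  · rw [modByMonic_eq_sub_mul_div, eval_sub, hp, eval_mul]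
    simp [FiniteField.pow_card_sub_one_eq_one (α : F) α.ne_zero]
  · have hdeg : ((X : F[X]) ^ (Fintype.card F - 1) - 1).natDegree = Fintype.card F - 1 := by
      simpa using natDegree_X_pow_sub_C (n := Fintype.card F - 1) (r := (1 : F))
    rw [Fintype.card_units]
    refine (natDegree_modByMonic_lt _ hmonic fun h => hN ?_).trans_eq hdeg
    rw [← hdeg, h, natDegree_one]

/-- Let `g, f ∈ R = F_{q^m}[x]/⟨x^N - 1⟩` with `g` cyclotomic
(`g^q = g`), and let `Z_g^c = {α ∈ F_{q^m}^* : g(α) ≠ 0}`. Then `tr((fg)(α)) = 0`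
for every `α ∈ Z_g^c` iff `T(fg) = 0` in `R`; moreover `T(fg) = 0` iff
`g·T(f) = 0` in `R`. Here `T(f) = f + f^q + ... + f^{q^{m-1}}`,
`tr(x) = x + x^q + ... + x^{q^{m-1}}`, and evaluation on `R` is represented by a
function `ev` agreeing with polynomial evaluation at nonzero points. -/
theorem stmt_7 (q m : ℕ) (hq : IsPrimePow q) (hm : 1 ≤ m)
    (Fq F : Type) [Field Fq] [Fintype Fq] [Field F] [Fintype F] [Algebra Fq F]
    (hcq : Fintype.card Fq = q) (hcF : Fintype.card F = q ^ m)
    (N : ℕ) (hN : N = q ^ m - 1)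
    (ev : (Polynomial F ⧸ Ideal.span {(X : Polynomial F) ^ N - 1}) → F → F)
    (hev : ∀ (f : Polynomial F) (β : Fˣ),
      ev (Ideal.Quotient.mk (Ideal.span {(X : Polynomial F) ^ N - 1}) f) ↑β = f.eval ↑β)
    (T : (Polynomial F ⧸ Ideal.span {(X : Polynomial F) ^ N - 1}) →
         (Polynomial F ⧸ Ideal.span {(X : Polynomial F) ^ N - 1}))
    (hT : ∀ f, T f = ∑ i ∈ Finset.range m, f ^ q ^ i)
    (g f : Polynomial F ⧸ Ideal.span {(X : Polynomial F) ^ N - 1})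
    (hg : g ^ q = g) :
    ((∀ α : Fˣ, ev g ↑α ≠ 0 → ∑ j ∈ Finset.range m, (ev (f * g) ↑α) ^ q ^ j = 0) ↔
      T (f * g) = 0) ∧
    (T (f * g) = 0 ↔ g * T f = 0) := by
  have hq0 : q ≠ 0 := hq.pos.ne'
  have hgpow : ∀ i, g ^ q ^ i = g := fun i => by
    induction i with
    | zero => simp
    | succ i ih => rw [pow_succ, pow_mul, ih, hg]
  have hTmul : T (f * g) = g * T f := by
    rw [hT, hT, Finset.mul_sum]
    exact Finset.sum_congr rfl fun i _ => by rw [mul_pow, hgpow, mul_comm]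
  refine ⟨?_, by rw [hTmul]⟩
  obtain ⟨a, rfl⟩ := Ideal.Quotient.mk_surjective f
  obtain ⟨b, rfl⟩ := Ideal.Quotient.mk_surjective g
  have hTmk : T (Ideal.Quotient.mk _ a * Ideal.Quotient.mk _ b) =
      Ideal.Quotient.mk _ (∑ i ∈ Finset.range m, (a * b) ^ q ^ i) := by
    simp [hT]
  have hsum : ∀ α : Fˣ, (∑ i ∈ Finset.range m, (a * b) ^ q ^ i).eval (α : F) =
      ∑ i ∈ Finset.range m, ((a * b).eval (α : F)) ^ q ^ i := fun α => by
    simp [eval_finsetSum]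
  rw [hTmk]
  simp only [← map_mul, hev, ← hsum]
  constructor
  · intro h
    rw [Ideal.Quotient.eq_zero_iff_mem, Ideal.mem_span_singleton, hN, ← hcF]
    refine X_pow_card_sub_one_dvd_of_eval_units_eq_zero fun α => ?_
    by_cases hb : b.eval (α : F) = 0
    · rw [hsum]
      exact Finset.sum_eq_zero fun i _ => by
        rw [eval_mul, hb, mul_zero, zero_pow (pow_ne_zero i hq0)]
    · exact h α hb
  · intro h α _
    rw [← hev, h, ← map_zero (Ideal.Quotient.mk _), hev, eval_zero]
end

section
/- Let η be a generator of F_{q^m}^*, let I_b be a minimal cyclotomic coset with smallest element b and cardinality n_b, and for 0 ≤ k < m and 1 ≤ ℓ ≤ n_b − 1 set g_{b,k,ℓ} = η^k x^b − η^{k q^ℓ} x^{b q^ℓ mod N} ∈ R. Let γ_0, ..., γ_{m−n_b−1} be an F_q-basis of the kernel of the relative trace map tr_{F_{q^m}/F_{q^{n_b}}} : F_{q^m} → F_{q^{n_b}}, x ↦ Σ_{j=0}^{m/n_b − 1} x^{q^{n_b·j}}, where F_{q^{n_b}} is the subfield of F_{q^m} with q^{n_b} elements. Then the family {g_{b,k,ℓ}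 : 0 ≤ k < m, 1 ≤ ℓ ≤ n_b − 1} ∪ {γ_i x^b : 0 ≤ i < m − n_b} is an F_q-basis of the space F_b = {f ∈ R : supp(f) ⊆ I_b and T(f) = 0}. -/
open Polynomial

lemma image_iterate_range_of_isPeriodicPt {α : Type*} [DecidableEq α] {f : α → α} {x : α} {m : ℕ}
    (hm : 0 < m) (h : Function.IsPeriodicPt f m x) :
    (Finset.range m).image (fun i => f^[i] x) =
      (Finset.range (Function.minimalPeriod f x)).image (fun i => f^[i] x) := by
  have hd : 0 < Function.minimalPeriod f x := h.minimalPeriod_pos hm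
  have hle : Function.minimalPeriod f x ≤ m := h.minimalPeriod_le hm
  ext y
  simp only [Finset.mem_image, Finset.mem_range]
  constructor
  · rintro ⟨i, -, rfl⟩
    exact ⟨i % Function.minimalPeriod f x, Nat.mod_lt _ hd,
      Function.iterate_mod_minimalPeriod_eq⟩
  · rintro ⟨i, hi, rfl⟩
    exact ⟨i, hi.trans_le hle, rfl⟩

lemma card_image_iterate_range_of_isPeriodicPt {α : Type*} [DecidableEq α] {f : α → α} {x : α}
    {m : ℕ} (hm : 0 < m) (h : Function.IsPeriodicPt f m x) :
    ((Finset.range m).image (fun i => f^[i] x)).card = Function.minimalPeriod f x := by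
  rw [image_iterate_range_of_isPeriodicPt hm h, Finset.card_image_of_injOn, Finset.card_range]
  intro i hi j hj hij
  exact Function.iterate_injOn_Iio_minimalPeriod (by simpa using hi) (by simpa using hj) hij

lemma iterate_mul_mod (q N b i : ℕ) (hb : b < N) :
    (fun x => x * q % N)^[i] b = b * q ^ i % N := by
  induction i with
  | zero => simp [Nat.mod_eq_of_lt hb]
  | succ i ih =>
    rw [Function.iterate_succ_apply', ih, pow_succ, ← mul_assoc]
    simp

lemma sum_range_mul_eq {M : Type*} [AddCommMonoid M] (g : ℕ → M) (n k : ℕ) :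
    ∑ i ∈ Finset.range (n * k), g i =
      ∑ l ∈ Finset.range n, ∑ j ∈ Finset.range k, g (n * j + l) := by
  rw [Finset.sum_comm]
  induction k with
  | zero => simp
  | succ k ih => rw [Nat.mul_succ, Finset.sum_range_add, ih, Finset.sum_range_succ]

lemma sum_range_add_of_periodic {M : Type*} [AddCommMonoid M] (g : ℕ → M) (m l : ℕ)
    (h : ∀ i, g (i + m) = g i) :
    ∑ i ∈ Finset.range m, g (i + l) = ∑ i ∈ Finset.range m, g i := by
  induction l with
  | zero => rfl
  | succ l ih =>
    rw [← ih]
    cases m with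
    | zero => rfl
    | succ m =>
      rw [Finset.sum_range_succ, Finset.sum_range_succ' (fun i => g (i + l)) m]
      congr 1
      · exact Finset.sum_congr rfl fun i _ => by congr 1; omega
      · rw [← h (0 + l)]; congr 1; omega

section Abstract

variable {K V R ι : Type*} [Field K] [AddCommGroup V] [Module K V] [AddCommGroup R] [Module K R]

/-- The differences `W 0 v - W l v`, with `v` in a basis and `l ≠ 0`, and the values of `W 0`
at a linearly independent family are linearly independent if the maps `W l` are. -/
lemma linearIndependent_differences [Fintype ι] {n m : ℕ} (W : ℕ → V →ₗ[K] R)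
    (hW : ∀ a : ℕ → V, ∑ l ∈ Finset.range (n + 1), W l (a l) = 0 → ∀ l < n + 1, a l = 0)
    {e : Fin m → V} (he : LinearIndependent K e) {γ : ι → V} (hγ : LinearIndependent K γ)
    (fam : (Fin m × Fin n) ⊕ ι → R)
    (h₁ : ∀ k l, fam (Sum.inl (k, l)) = W 0 (e k) - W (l + 1) (e k))
    (h₂ : ∀ i, fam (Sum.inr i) = W 0 (γ i)) : LinearIndependent K fam := by
  rw [Fintype.linearIndependent_iff] at he hγ ⊢
  intro c hc
  let s : ℕ → V := fun l => if hl : l < n then ∑ k, c (Sum.inl (k, ⟨l, hl⟩)) • e k else 0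
  let d : V := ∑ i, c (Sum.inr i) • γ i
  let a : ℕ → V := fun l => if l = 0 then ∑ l ∈ Finset.range n, s l + d else - s (l - 1)
  have hs (l : Fin n) : s l = ∑ k, c (Sum.inl (k, l)) • e k := by simp [s]
  have ha : ∑ l ∈ Finset.range (n + 1), W l (a l) = 0 := by
    rw [← hc, Finset.sum_range_succ', Fintype.sum_sum_type, Fintype.sum_prod_type_right]
    simp only [h₁, h₂, smul_sub, ← map_smul, Finset.sum_sub_distrib, ← map_sum, ← hs]
    simp only [a, map_sum, Finset.sum_range, d]
    simp
    abel
  have ha₀ := hW a ha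
  have hs₀ (l : Fin n) : s l = 0 := by simpa [a] using ha₀ (l + 1) (by omega)
  have hd : d = 0 := by simpa [a, Finset.sum_range, hs₀] using ha₀ 0 (by omega)
  rintro (⟨k, l⟩ | i)
  · exact he _ ((hs l).symm.trans (hs₀ l)) k
  · exact hγ _ hd i

lemma sum_mem_span_differences {n m : ℕ} (W : ℕ → V →ₗ[K] R)
    {e : Fin m → V} (he : Submodule.span K (Set.range e) = ⊤) {γ : ι → V}
    (fam : (Fin m × Fin n) ⊕ ι → R)
    (h₁ : ∀ k l, fam (Sum.inl (k, l)) = W 0 (e k) - W (l + 1) (e k))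
    (h₂ : ∀ i, fam (Sum.inr i) = W 0 (γ i)) (a : ℕ → V)
    (ha : ∑ l ∈ Finset.range (n + 1), a l ∈ Submodule.span K (Set.range γ)) :
    ∑ l ∈ Finset.range (n + 1), W l (a l) ∈ Submodule.span K (Set.range fam) := by
  have hγ : Submodule.span K (Set.range γ) ≤ (Submodule.span K (Set.range fam)).comap (W 0) := by
    rw [Submodule.span_le]
    rintro _ ⟨i, rfl⟩
    exact Submodule.subset_span ⟨Sum.inr i, h₂ i⟩
  have hd (l : Fin n) (v : V) : (W 0 - W (l + 1)) v ∈ Submodule.span K (Set.range fam) := by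
    have : Submodule.span K (Set.range e) ≤
        (Submodule.span K (Set.range fam)).comap (W 0 - W (l + 1)) := by
      rw [Submodule.span_le]
      rintro _ ⟨k, rfl⟩
      exact Submodule.subset_span ⟨Sum.inl (k, l), h₁ k l⟩
    exact this (he ▸ Submodule.mem_top)
  have key : ∑ l ∈ Finset.range (n + 1), W l (a l) =
      W 0 (∑ l ∈ Finset.range (n + 1), a l) - ∑ l : Fin n, (W 0 - W (l + 1)) (a (l + 1)) := by
    rw [map_sum, Finset.sum_range_succ', Finset.sum_range_succ', Finset.sum_range,
      Finset.sum_range]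
    simp only [LinearMap.sub_apply, Finset.sum_sub_distrib]
    abel
  rw [key]
  exact sub_mem (hγ ha) (sum_mem fun l _ => hd l _)

end Abstract

lemma minpoly_natDegree_of_powers {K F : Type*} [Field K] [Field F] [Finite F] [Algebra K F]
    (η : Fˣ) (hη : ∀ β : Fˣ, ∃ i : ℕ, η ^ i = β) :
    (minpoly K (η : F)).natDegree = Module.finrank K F := by
  have : FiniteDimensional K F := Module.Finite.of_finite
  have : Finite K := Finite.of_injective _ (algebraMap K F).injective
  rw [← Field.primitive_element_iff_minpoly_natDegree_eq, eq_top_iff]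
  intro x _
  rcases eq_or_ne x 0 with rfl | hx
  · exact zero_mem _
  · obtain ⟨i, hi⟩ := hη (Units.mk0 x hx)
    have : x = (η : F) ^ i := by rw [← Units.val_pow_eq_pow_val, hi, Units.val_mk0]
    rw [this]
    exact pow_mem (IntermediateField.mem_adjoin_simple_self K _) i

section Frobenius

variable {K F R : Type*} [Field K] [Fintype K] [Field F] [Algebra K F] [CommRing R]
  [Algebra K R] [Algebra F R] [IsScalarTower K F R]

lemma frobeniusAlgHom_pow_apply (i : ℕ) (x : R) :
    (FiniteField.frobeniusAlgHom K R ^ i) x = x ^ Fintype.card K ^ i := by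
  rw [AlgHom.coe_pow, FiniteField.coe_frobeniusAlgHom, pow_iterate]

/-- The `K`-linear map `c ↦ (c • z) ^ (#K ^ i)`. -/
noncomputable def frobeniusTwist (K F : Type*) {R : Type*} [Field K] [Fintype K] [Field F]
    [Algebra K F] [CommRing R] [Algebra K R] [Algebra F R] [IsScalarTower K F R]
    (z : R) (i : ℕ) : F →ₗ[K] R :=
  (FiniteField.frobeniusAlgHom K R ^ i).toLinearMap ∘ₗ
    (LinearMap.toSpanSingleton F R z).restrictScalars K

lemma frobeniusTwist_apply (z : R) (i : ℕ) (c : F) :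
    frobeniusTwist K F z i c = c ^ Fintype.card K ^ i • z ^ Fintype.card K ^ i := by
  simp only [frobeniusTwist, LinearMap.comp_apply, LinearMap.restrictScalars_apply,
    AlgHom.toLinearMap_apply, LinearMap.toSpanSingleton_apply, frobeniusAlgHom_pow_apply]
  exact _root_.smul_pow _ _ _

lemma pow_card_pow_mul_of_pow_eq {M : Type*} [Monoid M] {q n : ℕ} {z : M} (h : z ^ q ^ n = z)
    (j : ℕ) : z ^ q ^ (n * j) = z := by
  induction j with
  | zero => simp
  | succ j ih => rw [Nat.mul_succ, pow_add, pow_mul, ih, h]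

lemma sum_pow_frobeniusTwist [Fintype F] {m n : ℕ} {z : R}
    (hF : Fintype.card F = Fintype.card K ^ m) (hz : z ^ Fintype.card K ^ n = z)
    (hn : n ∣ m) (a : ℕ → F) :
    ∑ i ∈ Finset.range m,
        (∑ l ∈ Finset.range n, frobeniusTwist K F z l (a l)) ^ Fintype.card K ^ i =
      ∑ l ∈ Finset.range n, frobeniusTwist K F z l
        (∑ j ∈ Finset.range (m / n), (∑ l ∈ Finset.range n, a l) ^ Fintype.card K ^ (n * j)) := by
  have hmul : m = n * (m / n) := (Nat.mul_div_cancel' hn).symm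
  have hzm : z ^ Fintype.card K ^ m = z := by
    rw [hmul]; exact pow_card_pow_mul_of_pow_eq hz _
  have hper (c : F) (i : ℕ) :
      frobeniusTwist K F z (i + m) c = frobeniusTwist K F z i c := by
    simp only [frobeniusTwist_apply]
    rw [add_comm, pow_add, pow_mul, pow_mul, hzm, ← hF, FiniteField.pow_card]
  have hred (c : F) (j l : ℕ) : frobeniusTwist K F z (n * j + l) c =
      frobeniusTwist K F z l (c ^ Fintype.card K ^ (n * j)) := by
    simp only [frobeniusTwist_apply]
    rw [pow_add, pow_mul c, pow_mul z, pow_card_pow_mul_of_pow_eq hz]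
  have hfrob (i : ℕ) : (∑ l ∈ Finset.range n, frobeniusTwist K F z l (a l)) ^ Fintype.card K ^ i =
      ∑ l ∈ Finset.range n, frobeniusTwist K F z (i + l) (a l) := by
    rw [← frobeniusAlgHom_pow_apply, map_sum]
    refine Finset.sum_congr rfl fun l _ => ?_
    simp only [frobeniusTwist_apply, frobeniusAlgHom_pow_apply]
    rw [_root_.smul_pow, ← pow_mul, ← pow_mul, ← pow_add, add_comm l]
  have hsum (c : F) (l : ℕ) : ∑ i ∈ Finset.range m, frobeniusTwist K F z (i + l) c =
      ∑ i ∈ Finset.range m, frobeniusTwist K F z i c :=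
    sum_range_add_of_periodic (fun i => frobeniusTwist K F z i c) m l (hper c)
  simp_rw [hfrob]
  rw [Finset.sum_comm]
  simp_rw [hsum]
  rw [Finset.sum_comm]
  simp_rw [← map_sum (frobeniusTwist K F z _)]
  conv_lhs => rw [hmul]
  rw [sum_range_mul_eq]
  simp_rw [hred, map_sum]

end Frobenius

/-- A polynomial of degree less than `N` vanishing modulo `X ^ N - 1` is zero. -/
lemma eq_zero_of_mk_eq_zero {F : Type*} [Field F] {N : ℕ} (hN : 0 < N) {p : F[X]}
    (hp : p.degree < (N : ℕ))
    (h : Ideal.Quotient.mk (Ideal.span {(X : F[X]) ^ N - 1}) p = 0) : p = 0 := by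
  rw [Ideal.Quotient.eq_zero_iff_mem, Ideal.mem_span_singleton] at h
  refine Polynomial.eq_zero_of_dvd_of_degree_lt h ?_
  rwa [← C_1, degree_X_pow_sub_C hN]

lemma mk_X_pow_mod {F : Type*} [Field F] (N k : ℕ) :
    Ideal.Quotient.mk (Ideal.span {(X : F[X]) ^ N - 1}) X ^ (k % N) =
      Ideal.Quotient.mk (Ideal.span {(X : F[X]) ^ N - 1}) X ^ k := by
  have h : Ideal.Quotient.mk (Ideal.span {(X : F[X]) ^ N - 1}) X ^ N = 1 := by
    rw [← map_pow, ← map_one (Ideal.Quotient.mk _), Ideal.Quotient.mk_eq_mk_iff_sub_mem]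
    exact Ideal.mem_span_singleton_self _
  conv_rhs => rw [← Nat.div_add_mod k N, pow_add, pow_mul, h, one_pow, one_mul]

lemma degree_sum_C_mul_X_pow_lt {F ι : Type*} [Field F] (s : Finset ι) {N : ℕ} {e : ι → ℕ}
    (he : ∀ l, e l < N) (a : ι → F) :
    degree (∑ l ∈ s, C (a l) * X ^ e l) < (N : WithBot ℕ) :=
  mem_degreeLT.1 <| sum_mem fun l _ => mem_degreeLT.2 <|
    (degree_C_mul_X_pow_le _ _).trans_lt (by exact_mod_cast he l)

lemma eq_zero_of_sum_mk_eq_zero {F ι : Type*} [Field F] (s : Finset ι) {N : ℕ} (hN : 0 < N)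
    {e : ι → ℕ} (he : ∀ l, e l < N) (hinj : Set.InjOn e s) (a : ι → F)
    (h : ∑ l ∈ s, Ideal.Quotient.mk (Ideal.span {(X : F[X]) ^ N - 1}) (C (a l) * X ^ e l) = 0) :
    ∀ l ∈ s, a l = 0 := by
  intro l hl
  rw [← map_sum] at h
  have h₀ := congrArg (fun p => p.coeff (e l))
    (eq_zero_of_mk_eq_zero hN (degree_sum_C_mul_X_pow_lt s he a) h)
  simp only [finsetSum_coeff, coeff_C_mul_X_pow, coeff_zero] at h₀
  rw [Finset.sum_eq_single l] at h₀
  · simpa using h₀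
  · intro j hj hne
    rw [if_neg fun h => hne (hinj hj hl h.symm)]
  · exact fun h => (h hl).elim

lemma frobeniusTwist_mk {K F : Type*} [Field K] [Fintype K] [Field F] [Algebra K F]
    (N b l : ℕ) (c : F) :
    frobeniusTwist K F (Ideal.Quotient.mk (Ideal.span {(X : F[X]) ^ N - 1}) X ^ b) l c =
      Ideal.Quotient.mk (Ideal.span {(X : F[X]) ^ N - 1})
        (C (c ^ Fintype.card K ^ l) * X ^ (b * Fintype.card K ^ l % N)) := by
  rw [frobeniusTwist_apply, map_mul, map_pow (Ideal.Quotient.mk _) X, mk_X_pow_mod,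
    ← pow_mul, Algebra.smul_def]
  rfl

/-- Let `η` generate `F_{q^m}^*`, let `I_b` be the minimal cyclotomic
coset of `Z_N` with smallest element `b` and cardinality `n_b`, and for
`0 ≤ k < m`, `1 ≤ ℓ ≤ n_b - 1` set `g_{b,k,ℓ} = η^k x^b - η^{k q^ℓ} x^{b q^ℓ mod N}`
in `R = F_{q^m}[x]/⟨x^N - 1⟩`. Let `γ_0, ..., γ_{m-n_b-1}` be an `F_q`-basis of the
kernel of the relative trace `tr_{F_{q^m}/F_{q^{n_b}}} : x ↦ Σ_{j<m/n_b} x^{q^{n_b j}}`.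
Then `{g_{b,k,ℓ}} ∪ {γ_i x^b}` is an `F_q`-basis of
`F_b = {f ∈ R : supp(f) ⊆ I_b, T(f) = 0}`, where `T(f) = Σ_{i<m} f^{q^i}` and the
support of an element of `R` is that of its representative of degree `< N`. -/
theorem stmt_13 (q m : ℕ) (hq : IsPrimePow q) (hm : 1 ≤ m)
    (Fq F : Type) [Field Fq] [Fintype Fq] [Field F] [Fintype F] [Algebra Fq F]
    (hcq : Fintype.card Fq = q) (hcF : Fintype.card F = q ^ m)
    (N : ℕ) (hN : N = q ^ m - 1)
    (η : Fˣ) (hη : ∀ β : Fˣ, ∃ i : ℕ, η ^ i = β)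
    (b : ℕ) (hbN : b < N)
    (Ib : Finset ℕ) (hIb : Ib = (Finset.range m).image fun i => b * q ^ i % N)
    (hb : ∀ c ∈ Ib, b ≤ c)
    (nb : ℕ) (hnb : nb = Ib.card)
    (γ : Fin (m - nb) → F)
    (hγ0 : ∀ i, ∑ j ∈ Finset.range (m / nb), γ i ^ q ^ (nb * j) = 0)
    (hγ1 : LinearIndependent Fq γ)
    (hγ2 : ∀ x : F, (∑ j ∈ Finset.range (m / nb), x ^ q ^ (nb * j)) = 0 →
      x ∈ Submodule.span Fq (Set.range γ))
    (Fb : Set (Polynomial F ⧸ Ideal.span {(X : Polynomial F) ^ N - 1}))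
    (hFb : Fb = {x | (∑ i ∈ Finset.range m, x ^ q ^ i) = 0 ∧
      ∃ p : Polynomial F, p.degree < (N : ℕ) ∧ p.support ⊆ Ib ∧
        Ideal.Quotient.mk (Ideal.span {(X : Polynomial F) ^ N - 1}) p = x})
    (fam : (Fin m × Fin (nb - 1)) ⊕ Fin (m - nb) →
      Polynomial F ⧸ Ideal.span {(X : Polynomial F) ^ N - 1})
    (hfam1 : ∀ (k : Fin m) (l : Fin (nb - 1)),
      fam (Sum.inl (k, l)) = Ideal.Quotient.mk (Ideal.span {(X : Polynomial F) ^ N - 1})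
        (Polynomial.C ((η : F) ^ (k : ℕ)) * Polynomial.X ^ b -
         Polynomial.C ((η : F) ^ ((k : ℕ) * q ^ ((l : ℕ) + 1))) *
           Polynomial.X ^ (b * q ^ ((l : ℕ) + 1) % N)))
    (hfam2 : ∀ i : Fin (m - nb),
      fam (Sum.inr i) = Ideal.Quotient.mk (Ideal.span {(X : Polynomial F) ^ N - 1})
        (Polynomial.C (γ i) * Polynomial.X ^ b)) :
    LinearIndependent Fq fam ∧
    (∀ idx, fam idx ∈ Fb) ∧
    (∀ x ∈ Fb, x ∈ Submodule.span Fq (Set.range fam)) := by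
  subst hcq
  set q := Fintype.card Fq with hqdef
  have hN₀ : 0 < N := by omega
  have hq₀ : 0 < q := hq.pos
  set e : ℕ → ℕ := fun i => b * q ^ i % N with he
  have helt (i : ℕ) : e i < N := Nat.mod_lt _ hN₀
  have he₀ : e 0 = b := by simp [he, Nat.mod_eq_of_lt hbN]
  have hiter (i : ℕ) : (fun x => x * q % N)^[i] b = e i := iterate_mul_mod q N b i hbN
  have hper : Function.IsPeriodicPt (fun x => x * q % N) m b := by
    have hmod : q ^ m ≡ 1 [MOD N] :=
      ((Nat.modEq_iff_dvd' (Nat.one_le_pow _ _ hq₀)).2 (hN ▸ dvd_rfl)).symm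
    change (fun x => x * q % N)^[m] b = b
    rw [hiter]
    have h : b * q ^ m % N = b * 1 % N := hmod.mul_left b
    rwa [mul_one, Nat.mod_eq_of_lt hbN] at h
  have hnb' : nb = Function.minimalPeriod (fun x => x * q % N) b := by
    rw [hnb, hIb, ← card_image_iterate_range_of_isPeriodicPt hm hper]
    simp_rw [hiter]
  have hIb' : Ib = (Finset.range nb).image e := by
    have := image_iterate_range_of_isPeriodicPt hm hper
    simp_rw [hiter, ← hnb'] at this
    rw [hIb, this]
  have hinj : Set.InjOn e (Finset.range nb) := Finset.card_image_iff.1 (by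
    rw [← hIb', Finset.card_range, hnb])
  have hdvd : nb ∣ m := hnb' ▸ hper.minimalPeriod_dvd
  have henb : e nb = b := by
    rw [← hiter, hnb']
    exact Function.iterate_minimalPeriod
  have hnb₀ : 0 < nb := Nat.pos_of_dvd_of_pos hdvd hm
  clear_value q
  set z : F[X] ⧸ Ideal.span {(X : F[X]) ^ N - 1} :=
    Ideal.Quotient.mk (Ideal.span {(X : F[X]) ^ N - 1}) X ^ b with hz
  set W := frobeniusTwist Fq F z with hWdef
  have hW (l : ℕ) (c : F) : W l c =
      Ideal.Quotient.mk (Ideal.span {(X : F[X]) ^ N - 1}) (C (c ^ q ^ l) * X ^ e l) := by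
    rw [hWdef, hz, frobeniusTwist_mk, ← hqdef]
  have hW₀ (c : F) : W 0 c =
      Ideal.Quotient.mk (Ideal.span {(X : F[X]) ^ N - 1}) (C c * X ^ b) := by
    simp [hW, he₀]
  have hzq : z ^ q ^ nb = z := by
    rw [hz, ← pow_mul, ← mk_X_pow_mod N (b * q ^ nb)]
    exact congrArg _ henb
  have hT (a : ℕ → F) : ∑ i ∈ Finset.range m, (∑ l ∈ Finset.range nb, W l (a l)) ^ q ^ i =
      ∑ l ∈ Finset.range nb, W l
        (∑ j ∈ Finset.range (m / nb), (∑ l ∈ Finset.range nb, a l) ^ q ^ (nb * j)) := by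
    subst hqdef
    exact sum_pow_frobeniusTwist hcF hzq hdvd a
  have hindep (a : ℕ → F) (ha : ∑ l ∈ Finset.range nb, W l (a l) = 0) : ∀ l < nb, a l = 0 := by
    simp_rw [hW] at ha
    intro l hl
    exact pow_eq_zero_iff (pow_pos hq₀ l).ne' |>.1 <|
      eq_zero_of_sum_mk_eq_zero _ hN₀ helt hinj _ ha l (Finset.mem_range.2 hl)
  have hmem (a : ℕ → F) (ha : ∑ j ∈ Finset.range (m / nb),
      (∑ l ∈ Finset.range nb, a l) ^ q ^ (nb * j) = 0) :
      ∑ l ∈ Finset.range nb, W l (a l) ∈ Fb := by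
    rw [hFb]
    refine ⟨by simp [hT, ha], ∑ l ∈ Finset.range nb, C (a l ^ q ^ l) * X ^ e l,
      degree_sum_C_mul_X_pow_lt _ helt _, ?_, by simp_rw [hW, map_sum]⟩
    intro i hi
    rw [mem_support_iff, finsetSum_coeff] at hi
    obtain ⟨l, hl, hne⟩ := Finset.exists_ne_zero_of_sum_ne_zero hi
    rw [coeff_C_mul_X_pow] at hne
    rw [hIb']
    exact Finset.mem_image.2 ⟨l, hl, by by_contra h; exact hne (if_neg (Ne.symm h))⟩
  have hrep (x : F[X] ⧸ Ideal.span {(X : F[X]) ^ N - 1}) (hx : x ∈ Fb) : ∃ a : ℕ → F,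
      x = ∑ l ∈ Finset.range nb, W l (a l) ∧
      ∑ j ∈ Finset.range (m / nb), (∑ l ∈ Finset.range nb, a l) ^ q ^ (nb * j) = 0 := by
    rw [hFb] at hx
    obtain ⟨hx₀, p, -, hp, rfl⟩ := hx
    have hsurj (l : ℕ) : ∃ c : F, c ^ q ^ l = p.coeff (e l) := by
      obtain ⟨c, hc⟩ := Finite.surjective_of_injective
        (FiniteField.frobeniusAlgHom Fq F ^ l).toRingHom.injective (p.coeff (e l))
      exact ⟨c, by rw [← hc, hqdef]; exact (frobeniusAlgHom_pow_apply l c).symm⟩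
    choose a ha using hsurj
    have hpa : Ideal.Quotient.mk (Ideal.span {(X : F[X]) ^ N - 1}) p =
        ∑ l ∈ Finset.range nb, W l (a l) := by
      simp_rw [hW, ha, ← map_sum]
      congr 1
      conv_lhs => rw [p.as_sum_support_C_mul_X_pow]
      rw [Finset.sum_subset hp fun i _ hi => by simp [notMem_support_iff.1 hi], hIb',
        Finset.sum_image hinj]
    refine ⟨a, hpa, ?_⟩
    rw [hpa, hT] at hx₀
    exact hindep (fun _ => _) hx₀ 0 hnb₀
  have hrank : Module.finrank Fq F = m := by
    have h := Module.card_eq_pow_finrank (K := Fq) (V := F)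
    rw [hcF, ← hqdef] at h
    exact (Nat.pow_right_injective hq.two_le h).symm
  have hli : LinearIndependent Fq fun k : Fin m => (η : F) ^ (k : ℕ) := by
    have h := linearIndependent_pow (K := Fq) (η : F)
    rwa [minpoly_natDegree_of_powers η hη, hrank] at h
  have hspan : Submodule.span Fq (Set.range fun k : Fin m => (η : F) ^ (k : ℕ)) = ⊤ :=
    hli.span_eq_top_of_card_eq_finrank' (by rw [Fintype.card_fin, hrank])
  clear_value W
  obtain ⟨n, rfl⟩ : ∃ n, nb = n + 1 := ⟨nb - 1, by omega⟩
  have h₁ (k : Fin m) (l : Fin n) : fam (Sum.inl (k, l)) =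
      W 0 ((η : F) ^ (k : ℕ)) - W (l + 1) ((η : F) ^ (k : ℕ)) := by
    rw [hW₀, hW, ← map_sub, ← pow_mul]
    exact hfam1 k l
  have h₂ (i : Fin (m - (n + 1))) : fam (Sum.inr i) = W 0 (γ i) := by rw [hW₀, hfam2]
  refine ⟨linearIndependent_differences W hindep hli hγ1 fam h₁ h₂, ?_, ?_⟩
  · have hsingle (l : ℕ) (hl : l < n + 1) (c : F) :
        ∑ j ∈ Finset.range (n + 1), W j (Pi.single (M := fun _ => F) l c j) = W l c := by
      rw [Finset.sum_eq_single l (fun j _ hj => by rw [Pi.single_eq_of_ne hj, map_zero])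
        (fun h => (h (Finset.mem_range.2 hl)).elim), Pi.single_eq_same]
    rintro (⟨k, l⟩ | i)
    · have h := hmem (Pi.single 0 ((η : F) ^ (k : ℕ)) -
        Pi.single ((l : ℕ) + 1) ((η : F) ^ (k : ℕ)))
      have hl : (l : ℕ) + 1 < n + 1 := by omega
      simp only [Pi.sub_apply, map_sub, Finset.sum_sub_distrib, hsingle 0 hnb₀, hsingle _ hl] at h
      rw [h₁ k l]
      refine h (Finset.sum_eq_zero fun j _ => ?_)
      rw [Finset.sum_pi_single', Finset.sum_pi_single', if_pos (Finset.mem_range.2 hnb₀),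
        if_pos (Finset.mem_range.2 hl), sub_self, zero_pow (pow_pos hq₀ _).ne']
    · have h := hmem (Pi.single 0 (γ i))
      rw [hsingle 0 hnb₀, Finset.sum_pi_single', if_pos (Finset.mem_range.2 hnb₀), ← h₂] at h
      exact h (hγ0 i)
  · intro x hx
    obtain ⟨a, rfl, ha⟩ := hrep x hx
    exact sum_mem_span_differences W hspan fam h₁ h₂ a (hγ2 _ ha)
end

section
/- The kernel of T, i.e. the F_q-vector space {f ∈ R : T(f) = 0}, has F_q-dimension (m − 1)·N. -/
open Polynomial

/-- Evaluation at the units of a finite field, on `F[X]` modulo `X ^ |Fˣ| - 1`. -/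
noncomputable def evalUnits (F : Type*) [Field F] [Fintype F] {N : ℕ}
    (hN : N = Fintype.card F - 1) :
    (F[X] ⧸ Ideal.span {(X : F[X]) ^ N - 1}) →ₐ[F] (Fˣ → F) :=
  Ideal.Quotient.liftₐ _ (AlgHom.pi fun u : Fˣ => aeval (u : F)) (by
    intro p hp
    obtain ⟨r, rfl⟩ := Ideal.mem_span_singleton.mp hp
    ext u
    simp [hN, FiniteField.pow_card_sub_one_eq_one (u : F) u.ne_zero])

theorem evalUnits_mk {F : Type*} [Field F] [Fintype F] {N : ℕ}
    (hN : N = Fintype.card F - 1) (p : F[X]) (u : Fˣ) :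
    evalUnits F hN (Ideal.Quotient.mk _ p) u = p.eval (u : F) := by
  change aeval (u : F) p = _
  rw [coe_aeval_eq_eval]

theorem evalUnits_injective {F : Type*} [Field F] [Fintype F] {N : ℕ}
    (hN : N = Fintype.card F - 1) : Function.Injective (evalUnits F hN) := by
  classical
  have hN0 : N ≠ 0 := by
    have := Fintype.one_lt_card (α := F)
    omega
  rw [injective_iff_map_eq_zero]
  intro f hf
  obtain ⟨p, rfl⟩ := Ideal.Quotient.mk_surjective f
  have hmonic : ((X : F[X]) ^ N - 1).Monic := by
    simpa using monic_X_pow_sub_C (1 : F) hN0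
  have hdeg : ((X : F[X]) ^ N - 1).natDegree = N := by
    simpa using natDegree_X_pow_sub_C (n := N) (r := (1 : F))
  rw [Ideal.Quotient.eq_zero_iff_mem, Ideal.mem_span_singleton,
    ← modByMonic_eq_zero_iff_dvd hmonic]
  refine eq_zero_of_natDegree_lt_card_of_eval_eq_zero _ (f := fun u : Fˣ => (u : F))
    Units.val_injective (fun u => ?_) ?_
  · have h := congrFun hf u
    rw [evalUnits_mk] at h
    rw [modByMonic_eq_sub_mul_div]
    simpa [hN, FiniteField.pow_card_sub_one_eq_one (u : F) u.ne_zero] using h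
  · rw [Fintype.card_units, ← hN]
    calc _ < ((X : F[X]) ^ N - 1).natDegree :=
          natDegree_modByMonic_lt _ hmonic (fun h => hN0 (by rw [← hdeg, h, natDegree_one]))
      _ = N := hdeg

theorem evalUnits_surjective {F : Type*} [Field F] [Fintype F] {N : ℕ}
    (hN : N = Fintype.card F - 1) : Function.Surjective (evalUnits F hN) := by
  classical
  intro g
  refine ⟨Ideal.Quotient.mk _
    (Lagrange.interpolate Finset.univ (fun u : Fˣ => (u : F)) g), funext fun u => ?_⟩
  rw [evalUnits_mk]
  exact Lagrange.eval_interpolate_at_node _ Units.val_injective.injOn (Finset.mem_univ u)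

/-- The kernel of the `F_q`-linear map `T : R → R`,
`T(f) = f + f^q + ... + f^{q^{m-1}}`, on `R = F_{q^m}[x]/⟨x^N - 1⟩`
(an `F_q`-vector space of dimension `mN`), has `F_q`-dimension `(m - 1)·N`. -/
theorem stmt_14 (q m : ℕ) (hq : IsPrimePow q) (hm : 1 ≤ m)
    (Fq F : Type) [Field Fq] [Fintype Fq] [Field F] [Fintype F] [Algebra Fq F]
    (hcq : Fintype.card Fq = q) (hcF : Fintype.card F = q ^ m)
    (N : ℕ) (hN : N = q ^ m - 1)
    (T : (Polynomial F ⧸ Ideal.span {(X : Polynomial F) ^ N - 1}) →ₗ[Fq]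
         (Polynomial F ⧸ Ideal.span {(X : Polynomial F) ^ N - 1}))
    (hT : ∀ f, T f = ∑ i ∈ Finset.range m, f ^ q ^ i) :
    Module.finrank Fq (LinearMap.ker T) = (m - 1) * N := by
  classical
  have hN' : N = Fintype.card F - 1 := by rw [hN, hcF]
  have hrank : Module.finrank Fq F = m := by
    have h := Module.card_eq_pow_finrank (K := Fq) (V := F)
    rw [hcF, hcq] at h
    exact (Nat.pow_right_injective hq.two_le h).symm
  let e : (F[X] ⧸ Ideal.span {(X : F[X]) ^ N - 1}) ≃ₗ[Fq] (Fˣ → F) :=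
    LinearEquiv.ofBijective ((evalUnits F hN').toLinearMap.restrictScalars Fq)
      ⟨evalUnits_injective hN', evalUnits_surjective hN'⟩
  let g := (Algebra.trace Fq F).compLeft Fˣ ∘ₗ e.toLinearMap
  have hg : Function.Surjective g :=
    ((Algebra.trace_surjective Fq F).comp_left).comp e.surjective
  have hker : LinearMap.ker T = LinearMap.ker g := by
    ext f
    have key : ∀ u, algebraMap Fq F (g f u) = evalUnits F hN' (T f) u := by
      intro u
      change algebraMap Fq F (Algebra.trace Fq F (evalUnits F hN' f u)) = _
      rw [FiniteField.algebraMap_trace_eq_sum_pow, hT, hrank, Nat.card_eq_fintype_card, hcq]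
      simp
    rw [LinearMap.mem_ker, LinearMap.mem_ker, ← map_eq_zero_iff _ (evalUnits_injective hN'),
      funext_iff, funext_iff]
    refine forall_congr' fun u => ?_
    rw [← key, Pi.zero_apply, Pi.zero_apply, map_eq_zero]
  have : Module.Finite Fq (F[X] ⧸ Ideal.span {(X : F[X]) ^ N - 1}) :=
    Module.Finite.equiv e.symm
  have h := g.finrank_range_add_finrank_ker
  rw [LinearMap.range_eq_top.mpr hg, finrank_top, e.finrank_eq, Module.finrank_pi,
    Module.finrank_pi_fintype, ← hker] at h
  simp only [hrank, Finset.sum_const, Finset.card_univ, Fintype.card_units, ← hN',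
    smul_eq_mul] at h
  rw [Nat.sub_mul, one_mul, mul_comm m N]
  omega
end
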